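/- Let K be a complex Hilbert space and B a positive operator on K with 0 < B < I (i.e., B and I − B are positive and injective), and let T = (B ⊕ (−B)) + I on H = K ⊕ K. For each unitary U ∈ B(K) commuting with B define P_U = (1/2)·[[I + B, (I − B²)^{1/2}U],[U*(I − B²)^{1/2}, I − B]] and Q_U = (1/2)·[[I + B, −(I − B²)^{1/2}U],[−U*(I − B²)^{1/2}, I − B]] as 2×2 block operators on K ⊕ K. Then every (P_U, Q_U) is a pair of orthogonal projections with P_U + Q_U = T, and conversely every pair (P, Q) of orthogonal projections on H with T = P + Q equals (P_U, Q_U) for some unitary U ∈ B(K) commuting with B. -/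

import Mathlib

set_option synthInstance.maxHeartbeats 400000
set_option maxHeartbeats 800000

noncomputable section

/-- `P` is an orthogonal projection: self-adjoint and idempotent. -/
def IsOrthoProj {H : Type*} [NormedAddCommGroup H] [InnerProductSpace ℂ H] [CompleteSpace H]
    (P : H →L[ℂ] H) : Prop :=
  IsSelfAdjoint P ∧ P * P = P

/-- Strict operator inequality `A < B`: `B − A` is positive and injective. -/
def OpLt {H : Type*} [NormedAddCommGroup H] [InnerProductSpace ℂ H] [CompleteSpace H]
    (A B : H →L[ℂ] H) : Prop :=
  (B - A).IsPositive ∧ Function.Injective (B - A)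

/-- The block operator `[[A, B], [C, D]]` on the Hilbert space direct sum `K ⊕₂ K`. -/
def blk {K : Type*} [NormedAddCommGroup K] [InnerProductSpace ℂ K]
    (A B C D : K →L[ℂ] K) : WithLp 2 (K × K) →L[ℂ] WithLp 2 (K × K) :=
  ((WithLp.prodContinuousLinearEquiv 2 ℂ K K).symm : K × K →L[ℂ] WithLp 2 (K × K)) ∘L
    ((A.coprod B).prod (C.coprod D)) ∘L
    ((WithLp.prodContinuousLinearEquiv 2 ℂ K K) : WithLp 2 (K × K) →L[ℂ] K × K)

variable {K : Type*} [NormedAddCommGroup K] [InnerProductSpace ℂ K] [CompleteSpace K]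

/-- The projection `P_U = (1/2)·[[I + B, (I − B²)^{1/2}U], [U*(I − B²)^{1/2}, I − B]]`. -/
def PU1 (B U : K →L[ℂ] K) : WithLp 2 (K × K) →L[ℂ] WithLp 2 (K × K) :=
  (((2 : ℝ)⁻¹ : ℝ) : ℂ) •
    blk (1 + B) (CFC.sqrt (1 - B ^ 2) * U) (star U * CFC.sqrt (1 - B ^ 2)) (1 - B)

/-- The projection `Q_U = (1/2)·[[I + B, −(I − B²)^{1/2}U], [−U*(I − B²)^{1/2}, I − B]]`. -/
def QU1 (B U : K →L[ℂ] K) : WithLp 2 (K × K) →L[ℂ] WithLp 2 (K × K) :=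
  (((2 : ℝ)⁻¹ : ℝ) : ℂ) •
    blk (1 + B) (-(CFC.sqrt (1 - B ^ 2) * U)) (-(star U * CFC.sqrt (1 - B ^ 2))) (1 - B)

section Block

omit [CompleteSpace K]

lemma blk_apply (A B C D : K →L[ℂ] K) (x : WithLp 2 (K × K)) :
    blk A B C D x = WithLp.toLp 2 (A x.fst + B x.snd, C x.fst + D x.snd) := rfl

lemma blk_add (A B C D A' B' C' D' : K →L[ℂ] K) :
    blk A B C D + blk A' B' C' D' = blk (A + A') (B + B') (C + C') (D + D') := by
  ext x
  apply (WithLp.ofLp_injective 2)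
  ext <;> simp [blk_apply] <;> abel

lemma blk_mul (A B C D A' B' C' D' : K →L[ℂ] K) :
    blk A B C D * blk A' B' C' D' =
      blk (A * A' + B * C') (A * B' + B * D') (C * A' + D * C') (C * B' + D * D') := by
  ext x
  apply (WithLp.ofLp_injective 2)
  ext <;> simp [blk_apply] <;> abel

lemma blk_one : blk (1 : K →L[ℂ] K) 0 0 1 = 1 := by
  ext x
  apply (WithLp.ofLp_injective 2)
  ext <;> simp [blk_apply]

lemma blk_zero : blk (0 : K →L[ℂ] K) 0 0 0 = 0 := by
  ext x
  apply (WithLp.ofLp_injective 2)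
  ext <;> simp [blk_apply]

lemma blk_inj {A B C D A' B' C' D' : K →L[ℂ] K} :
    blk A B C D = blk A' B' C' D' ↔ A = A' ∧ B = B' ∧ C = C' ∧ D = D' := by
  refine ⟨fun h ↦ ?_, by rintro ⟨rfl, rfl, rfl, rfl⟩; rfl⟩
  have hx (x y : K) : (A x + B y, C x + D y) = (A' x + B' y, C' x + D' y) :=
    congrArg WithLp.ofLp (DFunLike.congr_fun h (WithLp.toLp 2 (x, y)))
  simp only [Prod.mk.injEq] at hx
  refine ⟨?_, ?_, ?_, ?_⟩ <;> ext x
  · simpa using (hx x 0).1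
  · simpa using (hx 0 x).1
  · simpa using (hx x 0).2
  · simpa using (hx 0 x).2

lemma exists_eq_blk (X : WithLp 2 (K × K) →L[ℂ] WithLp 2 (K × K)) :
    ∃ A B C D : K →L[ℂ] K, X = blk A B C D := by
  let e := WithLp.prodContinuousLinearEquiv 2 ℂ K K
  let Y : K × K →L[ℂ] K × K := (e : _ →L[ℂ] K × K) ∘L X ∘L (e.symm : K × K →L[ℂ] _)
  refine ⟨.fst ℂ K K ∘L Y ∘L .inl ℂ K K, .fst ℂ K K ∘L Y ∘L .inr ℂ K K,
    .snd ℂ K K ∘L Y ∘L .inl ℂ K K, .snd ℂ K K ∘L Y ∘L .inr ℂ K K, ?_⟩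
  ext x
  have hx : X x = X (WithLp.toLp 2 (x.fst, 0)) + X (WithLp.toLp 2 (0, x.snd)) := by
    rw [← map_add, ← WithLp.toLp_add]
    simp
    rfl
  rw [hx]
  rfl

end Block

lemma star_blk (A B C D : K →L[ℂ] K) :
    star (blk A B C D) = blk (star A) (star C) (star B) (star D) := by
  rw [ContinuousLinearMap.star_eq_adjoint, eq_comm, ContinuousLinearMap.eq_adjoint_iff]
  intro x y
  simp only [blk_apply, WithLp.prod_inner_apply, inner_add_left, inner_add_right,
    ContinuousLinearMap.star_eq_adjoint, ContinuousLinearMap.adjoint_inner_left]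
  exact add_add_add_comm _ _ _ _

/-- If `Y` is a self-adjoint involution, then `(1 + Y) / 2` is an orthogonal projection. -/
lemma isOrthoProj_half_one_add {H : Type*} [NormedAddCommGroup H] [InnerProductSpace ℂ H]
    [CompleteSpace H] {Y : H →L[ℂ] H} (hY : IsSelfAdjoint Y) (hY2 : Y * Y = 1) :
    IsOrthoProj ((((2 : ℝ)⁻¹ : ℝ) : ℂ) • (1 + Y)) := by
  constructor
  · refine IsSelfAdjoint.smul ?_ (.add (.one _) hY)
    simp [isSelfAdjoint_iff]
  · have h : (1 + Y) * (1 + Y) = (2 : ℂ) • (1 + Y) := by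
      rw [mul_add, add_mul, add_mul, hY2, two_smul]
      simp only [one_mul, mul_one]
      abel
    rw [smul_mul_smul_comm, h, smul_smul]
    norm_num

/-- If `X` commutes with the self-adjoint `B` and `X X* = X* X = 1 - B²`, then
`(1 + [[B, X], [X*, -B]]) / 2` is an orthogonal projection. -/
lemma isOrthoProj_half_one_add_blk {B X : K →L[ℂ] K} (hB : IsSelfAdjoint B) (hXB : Commute X B)
    (h₁ : X * star X = 1 - B ^ 2) (h₂ : star X * X = 1 - B ^ 2) :
    IsOrthoProj ((((2 : ℝ)⁻¹ : ℝ) : ℂ) • (1 + blk B X (star X) (-B))) := by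
  apply isOrthoProj_half_one_add
  · rw [isSelfAdjoint_iff, star_blk, star_star, star_neg, hB.star_eq]
  · have hXB' : star X * B = B * star X := by
      simpa [hB.star_eq] using (congrArg star hXB.eq).symm
    rw [blk_mul, h₁, h₂, ← blk_one, blk_inj]
    refine ⟨?_, ?_, ?_, ?_⟩
    · noncomm_ring
    · rw [mul_neg, hXB.eq, add_neg_cancel]
    · rw [neg_mul, hXB', add_neg_cancel]
    · noncomm_ring

lemma star_sqrt (A : K →L[ℂ] K) : star (CFC.sqrt A) = CFC.sqrt A :=
  (CFC.sqrt_nonneg A).isSelfAdjoint.star_eq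

lemma PU1_eq (B U : K →L[ℂ] K) :
    PU1 B U = (((2 : ℝ)⁻¹ : ℝ) : ℂ) • (1 + blk B (CFC.sqrt (1 - B ^ 2) * U)
      (star (CFC.sqrt (1 - B ^ 2) * U)) (-B)) := by
  rw [PU1, ← blk_one, blk_add, star_mul, star_sqrt, zero_add, zero_add,
    sub_eq_add_neg 1 B]

lemma QU1_eq (B U : K →L[ℂ] K) :
    QU1 B U = (((2 : ℝ)⁻¹ : ℝ) : ℂ) • (1 + blk B (-(CFC.sqrt (1 - B ^ 2) * U))
      (star (-(CFC.sqrt (1 - B ^ 2) * U))) (-B)) := by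
  rw [QU1, ← blk_one, blk_add, star_neg, star_mul, star_sqrt, zero_add, zero_add,
    sub_eq_add_neg 1 B]

lemma half_smul_one_add_add {R : Type*} [Ring R] [Algebra ℂ R] {X Y S : R}
    (h : X + Y = S + S) :
    (((2 : ℝ)⁻¹ : ℝ) : ℂ) • (1 + X) + (((2 : ℝ)⁻¹ : ℝ) : ℂ) • (1 + Y) = 1 + S := by
  rw [← smul_add, add_add_add_comm, h, add_add_add_comm, ← two_smul ℂ, smul_smul]
  norm_num

lemma eq_half_smul_one_add {R : Type*} [Ring R] [Algebra ℂ R] (P Q : R) :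
    P = (((2 : ℝ)⁻¹ : ℝ) : ℂ) • (1 + (P + Q - 1 + (P - Q))) := by
  have h : 1 + (P + Q - 1 + (P - Q)) = (2 : ℂ) • P := by
    rw [two_smul]
    abel
  rw [h, smul_smul]
  norm_num

lemma PU1_add_QU1 (B U : K →L[ℂ] K) : PU1 B U + QU1 B U = blk B 0 0 (-B) + 1 := by
  have h : blk B (CFC.sqrt (1 - B ^ 2) * U) (star (CFC.sqrt (1 - B ^ 2) * U)) (-B) +
      blk B (-(CFC.sqrt (1 - B ^ 2) * U)) (star (-(CFC.sqrt (1 - B ^ 2) * U))) (-B) =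
      blk B 0 0 (-B) + blk B 0 0 (-B) := by
    simp only [blk_add, star_neg, add_neg_cancel, add_zero]
  rw [PU1_eq, QU1_eq, add_comm _ (1 : WithLp 2 (K × K) →L[ℂ] _)]
  exact half_smul_one_add_add h

/-- Polar decomposition of an operator `X` with `X* X = R²`, where `R` is self-adjoint and
`R` and `X` have dense range. -/
lemma exists_unitary_mul_eq {X R : K →L[ℂ] K} (hR : IsSelfAdjoint R)
    (h : star X * X = R * R) (hRd : DenseRange R) (hXd : DenseRange X) :
    ∃ U ∈ unitary (K →L[ℂ] K), U * R = X := by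
  have hnorm (x : K) : ‖X x‖ = ‖R x‖ := by
    have hx : ‖X x‖ ^ 2 = ‖R x‖ ^ 2 := by
      rw [X.apply_norm_sq_eq_inner_adjoint_left, R.apply_norm_sq_eq_inner_adjoint_left,
        ← ContinuousLinearMap.star_eq_adjoint, ← ContinuousLinearMap.star_eq_adjoint, hR.star_eq]
      exact congrArg (fun A : K →L[ℂ] K ↦ RCLike.re (inner ℂ (A x) x)) h
    exact (sq_eq_sq₀ (norm_nonneg _) (norm_nonneg _)).mp hx
  let e : K ≃ₗᵢ[ℂ] K := (LinearEquiv.refl ℂ K).extendOfIsometry (R : K →ₗ[ℂ] K) (X : K →ₗ[ℂ] K)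
    hRd hXd hnorm
  refine ⟨(e.toContinuousLinearEquiv : K →L[ℂ] K),
    (Unitary.linearIsometryEquiv.symm e).2, ?_⟩
  ext x
  exact LinearEquiv.extendOfIsometry_eq (LinearEquiv.refl ℂ K) (R : K →ₗ[ℂ] K) (X : K →ₗ[ℂ] K)
    hRd hXd hnorm x

lemma denseRange_of_injective_star {X : K →L[ℂ] K} (h : Function.Injective ⇑(star X)) :
    DenseRange X := by
  have : X.rangeᗮ = ⊥ := by
    rw [X.orthogonal_range]
    exact LinearMap.ker_eq_bot.mpr h
  have hd := (Submodule.dense_iff_topologicalClosure_eq_top).mpr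
    ((Submodule.topologicalClosure_eq_top_iff).mpr this)
  rwa [LinearMap.coe_range] at hd

omit [CompleteSpace K] in
lemma injective_one_add_of_isPositive {B : K →L[ℂ] K} (hB : B.IsPositive) :
    Function.Injective ⇑(1 + B) := by
  rw [injective_iff_map_eq_zero]
  intro x hx
  have h : inner ℂ x x + inner ℂ (B x) x = 0 := by
    rw [← inner_add_left]
    exact (congrArg (fun y ↦ inner ℂ y x) hx).trans (inner_zero_left x)
  have hre := congrArg Complex.re h
  have h1 := hB.re_inner_nonneg_left x
  have h2 : 0 ≤ (inner ℂ x x : ℂ).re := inner_self_nonneg (𝕜 := ℂ)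
  have h3 : (inner ℂ x x : ℂ).re = 0 := by
    rw [Complex.add_re, Complex.zero_re] at hre
    exact le_antisymm (by linarith [show 0 ≤ (inner ℂ (B x) x : ℂ).re from h1]) h2
  rw [← norm_eq_zero, ← sq_eq_zero_iff, norm_sq_eq_re_inner (𝕜 := ℂ)]
  exact h3

/-- An operator which anticommutes with an injective positive operator vanishes. -/
lemma eq_zero_of_anticommute {A B : K →L[ℂ] K} (hB : B.IsPositive) (hinj : Function.Injective B)
    (h : B * A + A * B = 0) : A = 0 := by
  have hB0 : 0 ≤ B := (ContinuousLinearMap.nonneg_iff_isPositive B).mpr hB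
  have h' : B * A = -(A * B) := eq_neg_of_add_eq_zero_left h
  have h2 : Commute (B * B) A := by
    rw [commute_iff_eq, mul_assoc, h', mul_neg, ← mul_assoc, h', neg_mul, neg_neg, mul_assoc]
  have h3 : Commute B A := by
    have := h2.cfcₙ_nnreal NNReal.sqrt
    rwa [← CFC.sqrt, CFC.sqrt_mul_self B hB0] at this
  rw [← h3.eq, ← two_smul ℂ] at h
  have h4 : B * A = 0 := (smul_eq_zero.mp h).resolve_left two_ne_zero
  ext x
  exact hinj (by simpa using DFunLike.congr_fun h4 x)

lemma commute_sqrt_one_sub_sq {A B : K →L[ℂ] K} (h : Commute A B) :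
    Commute (CFC.sqrt (1 - B ^ 2)) A :=
  Commute.cfcₙ_nnreal ((Commute.one_left A).sub_left (h.symm.pow_left 2)) NNReal.sqrt

lemma one_sub_sq_nonneg {B : K →L[ℂ] K} (hB : B.IsPositive) (hB₂ : OpLt B 1) :
    0 ≤ 1 - B ^ 2 := by
  have h : 0 ≤ 1 - B := (ContinuousLinearMap.nonneg_iff_isPositive _).mpr hB₂.1
  have h' : 0 ≤ 1 + B :=
    add_nonneg zero_le_one ((ContinuousLinearMap.nonneg_iff_isPositive _).mpr hB)
  have hc : Commute (1 - B) (1 + B) := by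
    rw [commute_iff_eq]
    noncomm_ring
  have : 1 - B ^ 2 = (1 - B) * (1 + B) := by noncomm_ring
  rw [this]
  exact hc.mul_nonneg h h'

/-- A normal operator `X` commuting with an operator `B` such that `0 ≤ B < 1` and satisfying
`X X* = X* X = 1 - B²` has a polar decomposition whose unitary part commutes with `B`. -/
lemma exists_unitary_commute_sqrt_mul_eq {B X : K →L[ℂ] K} (hB : B.IsPositive)
    (hB₂ : OpLt B 1) (hXB : Commute X B)
    (h₁ : X * star X = 1 - B ^ 2) (h₂ : star X * X = 1 - B ^ 2) :
    ∃ U ∈ unitary (K →L[ℂ] K), Commute U B ∧ CFC.sqrt (1 - B ^ 2) * U = X := by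
  have hinj : Function.Injective ⇑(1 - B ^ 2 : K →L[ℂ] K) := by
    have : 1 - B ^ 2 = (1 - B) * (1 + B) := by noncomm_ring
    rw [this]
    exact hB₂.2.comp (injective_one_add_of_isPositive hB)
  set R := CFC.sqrt (1 - B ^ 2)
  have hR : IsSelfAdjoint R := (CFC.sqrt_nonneg _).isSelfAdjoint
  have hRR : R * R = 1 - B ^ 2 := CFC.sqrt_mul_sqrt_self _ (one_sub_sq_nonneg hB hB₂)
  have hRd : DenseRange R := denseRange_of_injective_star <| by
    rw [hR.star_eq]
    refine Function.Injective.of_comp (f := R) ?_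
    rwa [← hRR] at hinj
  have hXd : DenseRange X := denseRange_of_injective_star <| by
    refine Function.Injective.of_comp (f := X) ?_
    rwa [← h₁] at hinj
  obtain ⟨U, hU, hUR⟩ := exists_unitary_mul_eq hR (h₂.trans hRR.symm) hRd hXd
  have cancel {A C : K →L[ℂ] K} (h : A * R = C * R) : A = C :=
    ContinuousLinearMap.ext fun x ↦ congrFun
      (hRd.equalizer A.continuous C.continuous (funext fun x ↦ DFunLike.congr_fun h x)) x
  refine ⟨U, hU, cancel ?_, cancel ?_⟩
  · rw [mul_assoc, ← (commute_sqrt_one_sub_sq (Commute.refl B)).eq, ← mul_assoc, hUR, hXB.eq,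
      mul_assoc, hUR]
  · rw [mul_assoc, hUR, (commute_sqrt_one_sub_sq hXB).eq]

lemma sqrt_mul_unitary_spec {B U : K →L[ℂ] K} (hB : B.IsPositive) (hB₂ : OpLt B 1)
    (hU : U ∈ unitary (K →L[ℂ] K)) (hUB : Commute U B) :
    (CFC.sqrt (1 - B ^ 2) * U) * star (CFC.sqrt (1 - B ^ 2) * U) = 1 - B ^ 2 ∧
    star (CFC.sqrt (1 - B ^ 2) * U) * (CFC.sqrt (1 - B ^ 2) * U) = 1 - B ^ 2 ∧
    Commute (CFC.sqrt (1 - B ^ 2) * U) B := by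
  have hRR := CFC.sqrt_mul_sqrt_self _ (one_sub_sq_nonneg hB hB₂)
  have hRU := commute_sqrt_one_sub_sq hUB
  refine ⟨?_, ?_, (commute_sqrt_one_sub_sq (Commute.refl B)).mul_left hUB⟩
  · rw [star_mul, star_sqrt, mul_assoc, ← mul_assoc U, Unitary.mul_star_self_of_mem hU, one_mul,
      hRR]
  · rw [hRU.eq, star_mul, star_sqrt, mul_assoc, ← mul_assoc (star U),
      Unitary.star_mul_self_of_mem hU, one_mul, hRR]

lemma anticommute_of_idempotents {R : Type*} [Ring R] {P Q : R} (hP : P * P = P)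
    (hQ : Q * Q = Q) : (P + Q - 1) * (P - Q) + (P - Q) * (P + Q - 1) = 0 := by
  simp only [mul_sub, sub_mul, mul_add, add_mul, hP, hQ, one_mul, mul_one]
  abel

lemma sq_add_sq_of_idempotents {R : Type*} [Ring R] {P Q : R} (hP : P * P = P)
    (hQ : Q * Q = Q) : (P + Q - 1) * (P + Q - 1) + (P - Q) * (P - Q) = 1 := by
  simp only [mul_sub, sub_mul, mul_add, add_mul, hP, hQ, one_mul, mul_one]
  abel

/-- For `0 < B < I` and `T = (B ⊕ (−B)) + I`, the pairs of projections `(P, Q)` with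
`T = P + Q` are exactly the pairs `(P_U, Q_U)` for unitaries `U` commuting with `B`. -/
theorem sum_of_two_projections_classification
    (B : K →L[ℂ] K) (hBpos : B.IsPositive)
    (hB₁ : OpLt 0 B) (hB₂ : OpLt B 1)
    (T : WithLp 2 (K × K) →L[ℂ] WithLp 2 (K × K))
    (hT : T = blk B 0 0 (-B) + 1) :
    (∀ U : K →L[ℂ] K, U ∈ unitary (K →L[ℂ] K) → Commute U B →
      IsOrthoProj (PU1 B U) ∧ IsOrthoProj (QU1 B U) ∧ PU1 B U + QU1 B U = T) ∧
    (∀ P Q : WithLp 2 (K × K) →L[ℂ] WithLp 2 (K × K),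
      IsOrthoProj P → IsOrthoProj Q → T = P + Q →
      ∃ U ∈ unitary (K →L[ℂ] K), Commute U B ∧ P = PU1 B U ∧ Q = QU1 B U) := by
  subst hT
  have hBsa : IsSelfAdjoint B := hBpos.isSelfAdjoint
  have hBinj : Function.Injective B := by simpa using hB₁.2
  refine ⟨fun U hU hUB ↦ ?_, fun P Q hP hQ hPQ ↦ ?_⟩
  · obtain ⟨h₁, h₂, hc⟩ := sqrt_mul_unitary_spec hBpos hB₂ hU hUB
    rw [PU1_add_QU1, PU1_eq, QU1_eq]
    exact ⟨isOrthoProj_half_one_add_blk hBsa hc h₁ h₂,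
      isOrthoProj_half_one_add_blk hBsa hc.neg_left (by simpa using h₁) (by simpa using h₂), rfl⟩
  · have hS : blk B 0 0 (-B) = P + Q - 1 := eq_sub_of_add_eq hPQ
    obtain ⟨A, X, Y, D, hX⟩ := exists_eq_blk (P - Q)
    have hsa : star (P - Q) = P - Q := (hP.1.sub hQ.1).star_eq
    have hanti := anticommute_of_idempotents hP.2 hQ.2
    have hsq := sq_add_sq_of_idempotents hP.2 hQ.2
    rw [hX, star_blk, blk_inj] at hsa
    obtain ⟨-, -, rfl, -⟩ := hsa
    rw [← hS, hX, blk_mul, blk_mul, blk_add, ← blk_zero, blk_inj] at hanti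
    obtain ⟨hA, hXB, -, hD⟩ := hanti
    obtain rfl : A = 0 := eq_zero_of_anticommute hBpos hBinj (by simpa using hA)
    obtain rfl : D = 0 := eq_zero_of_anticommute hBpos hBinj (by
      rw [← neg_eq_zero, ← hD]; noncomm_ring)
    rw [← hS, hX, blk_mul, blk_mul, blk_add, ← blk_one, blk_inj] at hsq
    obtain ⟨h₁, -, -, h₂⟩ := hsq
    have hc : Commute X B := by
      rw [commute_iff_eq, eq_comm, ← sub_eq_zero, ← hXB]
      noncomm_ring
    obtain ⟨U, hU, hUB, rfl⟩ := exists_unitary_commute_sqrt_mul_eq hBpos hB₂ hc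
      (by rw [← h₁]; noncomm_ring) (by rw [← h₂]; noncomm_ring)
    have hP' : P = PU1 B U := by
      have h := eq_half_smul_one_add P Q
      rw [← hS, hX, blk_add, add_zero, zero_add, zero_add, add_zero] at h
      rw [PU1_eq]
      exact h
    refine ⟨U, hU, hUB, hP', ?_⟩
    rw [← PU1_add_QU1 B U, hP'] at hPQ
    exact (add_left_cancel hPQ).symm
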